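/- Let 0 < φ < π/4 and let C = { z ∈ ℝ² : ⟨z, e₁⟩ ≥ ‖z‖ cos φ } be the closed cone of half-angle φ about the positive x-axis (here e₁ = (1,0)). Let (x_i)_{i≥0} be a sequence of points in ℝ² with x_{i+1} − x_i ∈ C and x_{i+1} ≠ x_i for all i ≥ 0. Then the sets A_i = (x_i + C) ∩ B(x_i, ‖x_{i+1} − x_i‖), i ≥ 0, where B(x, r) is the open Euclidean ball of radius r centered at x, are pairwise disjoint. -/

import Mathlib

open Real
open scoped RealInnerProductSpace

section Cone

variable {E : Type*} [NormedAddCommGroup E] [InnerProductSpace ℝ E] {e u v : E} {c : ℝ}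

/-- The cone of half-angle `arccos c` about `e` is closed under addition. -/
lemma norm_mul_le_inner_add (hc : 0 ≤ c) (hu : ‖u‖ * c ≤ ⟪u, e⟫) (hv : ‖v‖ * c ≤ ⟪v, e⟫) :
    ‖u + v‖ * c ≤ ⟪u + v, e⟫ := by
  rw [inner_add_left]
  nlinarith [mul_le_mul_of_nonneg_right (norm_add_le u v) hc]

/-- In a cone of half-angle at most `π / 4`, the component orthogonal to the axis is at most the
component along it. -/
lemma norm_sub_inner_smul_le (he : ‖e‖ = 1) (hc : 0 ≤ c) (hc2 : 1 ≤ 2 * c ^ 2)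
    (hu : ‖u‖ * c ≤ ⟪u, e⟫) : ‖u - ⟪u, e⟫ • e‖ ≤ ⟪u, e⟫ := by
  have hn : 0 ≤ ‖u‖ * c := mul_nonneg (norm_nonneg u) hc
  refine abs_le_of_sq_le_sq' ?_ (hn.trans hu) |>.2
  have h : ‖u - ⟪u, e⟫ • e‖ ^ 2 = ‖u‖ ^ 2 - ⟪u, e⟫ ^ 2 := by
    rw [norm_sub_sq_real, inner_smul_right, norm_smul, he, mul_one, Real.norm_eq_abs, sq_abs]
    ring
  rw [h]
  nlinarith [pow_le_pow_left₀ hn hu 2, mul_le_mul_of_nonneg_left hc2 (sq_nonneg ‖u‖)]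

/-- Two vectors of a cone of half-angle at most `π / 4` make a non-obtuse angle. -/
lemma inner_nonneg_of_norm_mul_le_inner (he : ‖e‖ = 1) (hc : 0 ≤ c) (hc2 : 1 ≤ 2 * c ^ 2)
    (hu : ‖u‖ * c ≤ ⟪u, e⟫) (hv : ‖v‖ * c ≤ ⟪v, e⟫) : 0 ≤ ⟪u, v⟫ := by
  have hu' := norm_sub_inner_smul_le he hc hc2 hu
  have hv' := norm_sub_inner_smul_le he hc hc2 hv
  have h : ⟪u - ⟪u, e⟫ • e, v - ⟪v, e⟫ • e⟫ = ⟪u, v⟫ - ⟪u, e⟫ * ⟪v, e⟫ := by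
    simp only [inner_sub_left, inner_sub_right, real_inner_smul_left, real_inner_smul_right,
      real_inner_self_eq_norm_sq, he, real_inner_comm v e]
    ring
  have h1 := neg_le_of_abs_le (abs_real_inner_le_norm (u - ⟪u, e⟫ • e) (v - ⟪v, e⟫ • e))
  have h2 := mul_le_mul hu' hv' (norm_nonneg _) ((norm_nonneg _).trans hu')
  linarith

lemma norm_le_norm_add_of_inner_nonneg (h : 0 ≤ ⟪u, v⟫) : ‖u‖ ≤ ‖u + v‖ := by
  refine abs_le_of_sq_le_sq' ?_ (norm_nonneg _) |>.2
  rw [norm_add_sq_real]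
  nlinarith [sq_nonneg ‖v‖]

end Cone

/-- Let `0 < φ < π/4` and `C` the closed cone of half-angle `φ` about the
positive x-axis in `ℝ²`. If `(x_i)` is a sequence with `x_{i+1} - x_i ∈ C` and
`x_{i+1} ≠ x_i`, then the regions `A_i = (x_i + C) ∩ B(x_i, ‖x_{i+1} - x_i‖)` are
pairwise disjoint. -/
theorem cone_regions_pairwise_disjoint
    (φ : ℝ) (hφ0 : 0 < φ) (hφ : φ < π / 4)
    (C : Set (EuclideanSpace ℝ (Fin 2)))
    (hC : C = {z : EuclideanSpace ℝ (Fin 2) |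
      ‖z‖ * Real.cos φ ≤ ⟪z, EuclideanSpace.single (0 : Fin 2) (1 : ℝ)⟫})
    (x : ℕ → EuclideanSpace ℝ (Fin 2))
    (hcone : ∀ i, x (i + 1) - x i ∈ C) (hne : ∀ i, x (i + 1) ≠ x i) :
    Pairwise (Function.onFun Disjoint
      (fun i => {y : EuclideanSpace ℝ (Fin 2) | y - x i ∈ C} ∩
        Metric.ball (x i) ‖x (i + 1) - x i‖)) := by
  have hc : √2 / 2 ≤ Real.cos φ := by
    rw [← Real.cos_pi_div_four]
    exact Real.cos_le_cos_of_nonneg_of_le_pi hφ0.le (by linarith [Real.pi_pos]) hφ.le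
  have hc0 : 0 ≤ Real.cos φ := le_trans (by positivity) hc
  have hc2 : 1 ≤ 2 * Real.cos φ ^ 2 := by
    nlinarith [pow_le_pow_left₀ (by positivity) hc 2, Real.sq_sqrt (zero_le_two (α := ℝ))]
  have hadd : ∀ {u v}, u ∈ C → v ∈ C → u + v ∈ C := by
    subst hC
    exact norm_mul_le_inner_add hc0
  have hinner : ∀ {u v}, u ∈ C → v ∈ C → 0 ≤ ⟪u, v⟫ := by
    subst hC
    exact inner_nonneg_of_norm_mul_le_inner (by simp) hc0 hc2
  have hzero : (0 : EuclideanSpace ℝ (Fin 2)) ∈ C := by simp [hC]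
  have hmono : ∀ i j, i ≤ j → x j - x i ∈ C := by
    intro i j hij
    induction j, hij using Nat.le_induction with
    | base => simpa using hzero
    | succ j _ ih => simpa using hadd (hcone j) ih
  refine (pairwise_disjoint_on _).2 fun i j hij => Set.disjoint_left.2 ?_
  rintro y ⟨-, hy⟩ ⟨hyj, -⟩
  have hv : y - x (i + 1) ∈ C := by simpa using hadd hyj (hmono (i + 1) j hij)
  have h := norm_le_norm_add_of_inner_nonneg (hinner (hcone i) hv)
  rw [add_comm (x (i + 1) - x i), sub_add_sub_cancel] at h
  rw [mem_ball_iff_norm] at hy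
  exact h.not_gt hy
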